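/- arXiv:1111.1823 — 2 statements merged into one kernel-verified Lean document; each statement's English description precedes it below -/
import Mathlib

section
/- Let A = {a, b} and X = A² (the set of all words of length 2 over A). An infinite word s ∈ A^ω is a standard Sturmian word if and only if s = ψ_X(t) for some alternating t ∈ X^ω such that t ∈ ((aa)* ∪ (bb)*){ab, ba}^ω. -/
open List

/-- Right palindromic closure: `w⁺ = u Q u~` where `Q` is the longest palindromic
suffix of `w = uQ`; equivalently the shortest palindrome having `w` as a prefix. -/
noncomputable def palClosure {A : Type*} (w : List A) : List A :=
  letI : DecidablePred fun k => (w.drop k).reverse = w.drop k :=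
    fun _ => Classical.propDecidable _
  w ++ (w.take (Nat.find (⟨w.length, by simp⟩ :
    ∃ k, (w.drop k).reverse = w.drop k))).reverse

/-- The palindromization map `ψ_X` relative to a code `X`, evaluated on the
(unique) `X`-factorization `l = [x₁, …, xₙ]` of a word of `X*`. -/
noncomputable def psiList {A : Type*} (l : List (List A)) : List A :=
  l.foldl (fun p x => palClosure (p ++ x)) []

/-- The (usual) palindromization map `ψ` on words, letter by letter. -/
noncomputable def psiWord {A : Type*} (w : List A) : List A :=
  w.foldl (fun p a => palClosure (p ++ [a])) []

/-- `X` is a code: nonempty words with unique factorization over `X`. -/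
def IsCode {A : Type*} (X : Set (List A)) : Prop :=
  (∀ x ∈ X, x ≠ []) ∧
  ∀ l l' : List (List A), (∀ w ∈ l, w ∈ X) → (∀ w ∈ l', w ∈ X) →
    l.flatten = l'.flatten → l = l'

/-- `X` is a prefix code: nonempty words, none a proper prefix of another. -/
def IsPrefixCode {A : Type*} (X : Set (List A)) : Prop :=
  (∀ x ∈ X, x ≠ []) ∧ ∀ x ∈ X, ∀ y ∈ X, x <+: y → x = y

/-- `X` is a maximal prefix code over `A`. -/
def IsMaximalPrefixCode {A : Type*} (X : Set (List A)) : Prop :=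
  IsPrefixCode X ∧ ∀ Y : Set (List A), IsPrefixCode Y → X ⊆ Y → X = Y

/-- `w ∈ X*`. -/
def InStar {A : Type*} (X : Set (List A)) (w : List A) : Prop :=
  ∃ l : List (List A), (∀ u ∈ l, u ∈ X) ∧ l.flatten = w

/-- The finite word `w` is a prefix of the infinite word `s`. -/
def PrefixOfInf {A : Type*} (w : List A) (s : ℕ → A) : Prop :=
  ∀ i : ℕ, ∀ h : i < w.length, w.get ⟨i, h⟩ = s i

/-- The finite word `w` is a factor of the infinite word `s`. -/
def FactorOfInf {A : Type*} (w : List A) (s : ℕ → A) : Prop :=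
  ∃ i : ℕ, w = List.ofFn fun k : Fin w.length => s (i + k.1)

/-- `X` has finite deciphering delay. -/
def FiniteDecipheringDelay {A : Type*} (X : Set (List A)) : Prop :=
  ∃ k : ℕ, ∀ x ∈ X, ∀ x' ∈ X,
    (∃ (l l' : List (List A)) (r : List A),
      (∀ w ∈ l, w ∈ X) ∧ l.length = k ∧ (∀ w ∈ l', w ∈ X) ∧
      x ++ l.flatten ++ r = x' ++ l'.flatten) → x = x'

/-- The sequence `y = y₁y₂⋯ ∈ X^ω` is alternating. -/
def Alternating {A : Type*} (y : ℕ → List A) : Prop :=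
  ∃ a b : A, a ≠ b ∧ ∃ (lam : List A) (idx : ℕ → ℕ), StrictMono idx ∧
    ∀ k : ℕ, (lam ++ [a]) <+: y (idx (2 * k)) ∧ (lam ++ [b]) <+: y (idx (2 * k + 1))

/-- The infinite word `s` is ultimately periodic. -/
def UltimatelyPeriodic {A : Type*} (s : ℕ → A) : Prop :=
  ∃ p : ℕ, 0 < p ∧ ∃ N : ℕ, ∀ n ≥ N, s (n + p) = s n

/-- The infinite word `s` is uniformly recurrent: every factor occurs in every
sufficiently long factor of `s`. -/
def UniformlyRecurrent {A : Type*} (s : ℕ → A) : Prop :=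
  ∀ w : List A, FactorOfInf w s →
    ∃ N : ℕ, ∀ i : ℕ, w <:+: List.ofFn fun k : Fin N => s (i + k.1)

/-- Factor complexity of the infinite word `s`. -/
noncomputable def complexity {A : Type*} (s : ℕ → A) (n : ℕ) : ℕ :=
  {u : List A | u.length = n ∧ FactorOfInf u s}.ncard

/-- A word `w` is primitive if it is not a proper power. -/
def Primitive {A : Type*} (w : List A) : Prop :=
  ∀ (v : List A) (n : ℕ), 1 < n → w ≠ (List.replicate n v).flatten

theorem pc_spec (w : List Bool) : ∃ k ≤ w.length, (w.drop k).reverse = w.drop k ∧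
    (∀ j, (w.drop j).reverse = w.drop j → k ≤ j) ∧
    palClosure w = w ++ (w.take k).reverse := by
  classical
  have hex : ∃ k, (w.drop k).reverse = w.drop k := ⟨w.length, by simp⟩
  refine ⟨Nat.find hex, Nat.find_le (by simp), Nat.find_spec hex,
    fun j hj => Nat.find_le hj, ?_⟩
  unfold palClosure
  congr

theorem pc_hasPre (w : List Bool) : w <+: palClosure w := by
  obtain ⟨k, -, -, -, h⟩ := pc_spec w
  rw [h]; exact List.prefix_append _ _

theorem pc_pal (w : List Bool) : (palClosure w).reverse = palClosure w := by
  obtain ⟨k, hk, h1, h2, h⟩ := pc_spec w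
  rw [h]
  have : w = w.take k ++ w.drop k := (List.take_append_drop k w).symm
  generalize w.take k = u at *
  generalize w.drop k = v at *
  subst this
  simp [h1]

theorem pc_len (w : List Bool) : (palClosure w).length ≤ 2 * w.length := by
  obtain ⟨k, hk, h1, h2, h⟩ := pc_spec w
  rw [h]; simp; omega

theorem pal_rev_pre {w z : List Bool} (h : (w ++ z).reverse = w ++ z)
    (hl : z.length ≤ w.length) : z.reverse <+: w := by
  have h1 : z.reverse <+: w ++ z := by
    rw [← h, List.reverse_append]; exact List.prefix_append _ _
  exact List.prefix_of_prefix_length_le h1 (List.prefix_append w z) (by simpa using hl)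

theorem pc_min {w Z : List Bool} (hZ : Z.reverse = Z) (h : w <+: Z) :
    (palClosure w).length ≤ Z.length := by
  obtain ⟨k, hk, h1, h2, h3⟩ := pc_spec w
  obtain ⟨z, rfl⟩ := h
  rw [h3]
  simp only [List.length_append, List.length_reverse, List.length_take]
  by_cases hl : z.length ≤ w.length
  · obtain ⟨q, hq⟩ := pal_rev_pre hZ hl
    subst hq
    have := h2 z.length (by
      have e : z.length = z.reverse.length := by simp
      rw [e, List.drop_left]
      simpa using hZ)
    omega
  · omega

theorem pal_unique {w L L' : List Bool} (h : L.reverse = L) (h' : L'.reverse = L')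
    (p : w <+: L) (p' : w <+: L') (hl : L.length = L'.length) (hb : L.length ≤ 2 * w.length) :
    L = L' := by
  obtain ⟨z, rfl⟩ := p
  obtain ⟨z', rfl⟩ := p'
  simp only [List.length_append] at hl hb
  have h1 := pal_rev_pre h (by omega)
  have h2 := pal_rev_pre h' (by omega)
  have h3 := (List.prefix_of_prefix_length_le h1 h2 (by simp; omega)).eq_of_length
    (by simp; omega)
  rw [List.reverse_inj.mp h3]

theorem pc_unique {w L : List Bool} (h : L.reverse = L) (p : w <+: L)
    (hm : ∀ Z : List Bool, Z.reverse = Z → w <+: Z → L.length ≤ Z.length) :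
    palClosure w = L := by
  apply pal_unique (pc_pal w) h (pc_hasPre w) p _ (pc_len w)
  exact le_antisymm (pc_min h p) (hm _ (pc_pal w) (pc_hasPre w))

theorem pc_between {w w' : List Bool} (h : w <+: w') (h' : w' <+: palClosure w) :
    palClosure w' = palClosure w :=
  pc_unique (pc_pal w) h' fun _ hZ hp => pc_min hZ (h.trans hp)

theorem pc_of_pal {w : List Bool} (h : w.reverse = w) : palClosure w = w :=
  pc_unique h (List.prefix_refl w) fun _ _ hp => hp.length_le

/-- Invariant kept by the palindromization of words containing both letters. -/
def PalInv (p : List Bool) : Prop :=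
  p.reverse = p ∧ ∀ x : Bool, ∃ R : List Bool, R.reverse = R ∧ R ++ [x, !x] <+: p ∧
    ∀ R' : List Bool, R'.reverse = R' → R' ++ [x] <+: p → R'.length ≤ R.length

theorem PalInv.next {p : List Bool} (hp : PalInv p) (a : Bool) :
    p ++ [a, !a] <+: palClosure (p ++ [a]) := by
  obtain ⟨hpal, hx⟩ := hp
  obtain ⟨R, hR, hpre, hmax⟩ := hx a
  obtain ⟨S, hS⟩ := hpre
  have hp2 : p = S.reverse ++ [!a, a] ++ R := by
    rw [← hpal, ← hS]; simp [hR]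
  have key : palClosure (p ++ [a]) = p ++ [a] ++ ((!a) :: S) := by
    apply pc_unique
    · have : p ++ [a] ++ ((!a) :: S) = S.reverse ++ [!a, a] ++ R ++ [a] ++ ((!a) :: S) := by
        rw [hp2]
      rw [this]; simp [hR]
    · exact List.prefix_append _ _
    · intro Z hZ hpZ
      by_contra hlt
      push Not at hlt
      obtain ⟨z, rfl⟩ := hpZ
      have hlp : p.length = S.length + 2 + R.length := by rw [hp2]; simp; omega
      simp only [List.length_append, List.length_cons, List.length_nil] at hlt
      have h1 := pal_rev_pre hZ (by simp; omega)
      obtain ⟨q, hq⟩ := h1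
      -- q is a palindromic suffix of p ++ [a], too long
      have hqpal : q.reverse = q := by
        rw [← hq] at hZ; simpa using hZ
      have hql : z.length + q.length = p.length + 1 := by
        have := congrArg List.length hq; simpa using this
      rcases List.eq_nil_or_concat q with rfl | ⟨q1, e, rfl⟩
      · simp at hql; omega
      · simp only [List.concat_eq_append] at *
        rw [← List.append_assoc] at hq
        obtain ⟨hq1, he⟩ := List.append_inj' hq rfl
        simp only [List.cons.injEq, and_true] at he
        subst he
        rcases q1 with _ | ⟨f, q2⟩
        · simp at hql; omega
        · simp only [List.reverse_append, List.reverse_cons, List.reverse_nil, List.nil_append,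
            List.cons_append, List.cons.injEq] at hqpal
          obtain ⟨hef, hq2⟩ := hqpal
          subst hef
          have hq2' := (List.append_inj' hq2 rfl).1
          have := hmax q2 hq2' (by
            rw [← hpal, ← hq1]
            simp [hq2'])
          simp at hql
          omega
  rw [key]
  exact ⟨S, by simp⟩

theorem PalInv.closure {p : List Bool} (hp : PalInv p) (a : Bool) :
    PalInv (palClosure (p ++ [a])) := by
  have hn := hp.next a
  have hpa := pc_hasPre (p ++ [a])
  have hlong : ∀ R' : List Bool, R'.reverse = R' → ∀ x, R' ++ [x] <+: palClosure (p ++ [a]) →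
      R'.length ≤ p.length := by
    intro R' hR' x hx
    by_contra hlt
    have h1 : p ++ [a] <+: R' := List.prefix_of_prefix_length_le hpa
      ((List.prefix_append _ _).trans hx) (by simp; omega)
    have h2 := pc_min hR' h1
    have h3 := hx.length_le
    simp at h3; omega
  refine ⟨pc_pal _, fun x => ?_⟩
  by_cases hxa : x = a
  · subst hxa
    exact ⟨p, hp.1, hn, fun R' hR' h => hlong R' hR' _ h⟩
  · obtain ⟨R, hR, hpre, hmax⟩ := hp.2 x
    have hpp : p <+: palClosure (p ++ [a]) := (List.prefix_append _ _).trans hpa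
    refine ⟨R, hR, hpre.trans hpp, fun R' hR' h => ?_⟩
    have h1 := hlong R' hR' x h
    rcases h1.lt_or_eq with h2 | h2
    · exact hmax R' hR' (List.prefix_of_prefix_length_le h hpp (by simp; omega))
    · exfalso
      have h3 := (List.prefix_of_prefix_length_le h hpa (by simp; omega)).eq_of_length
        (by simp; omega)
      have := (List.append_inj' h3 rfl).2
      simp at this
      exact hxa this

theorem PalInv.two {p : List Bool} (hp : PalInv p) (a : Bool) :
    palClosure (p ++ [a, !a]) = palClosure (p ++ [a]) :=
  pc_between ⟨[!a], by simp⟩ (hp.next a)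

/-! ### The initial block -/

theorem block_getElem (c : Bool) (m : ℕ) (i : ℕ)
    (h : i < (replicate m c ++ [!c] ++ replicate m c).length) :
    (replicate m c ++ [!c] ++ replicate m c)[i] = if i = m then !c else c := by
  simp only [List.getElem_append, List.length_append, List.length_replicate,
    List.getElem_replicate, List.length_cons, List.length_nil, List.getElem_singleton]
  split_ifs <;> first | rfl | omega

theorem pal_getElem {Z : List Bool} (h : Z.reverse = Z) (i : ℕ) (hi : i < Z.length) :
    Z[i] = Z[Z.length - 1 - i] := by
  have : Z[i] = Z.reverse[i]'(by simpa using hi) := by simp only [h]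
  rw [this, List.getElem_reverse]

theorem block_closure (c : Bool) (m : ℕ) :
    palClosure (replicate m c ++ [!c]) = replicate m c ++ [!c] ++ replicate m c := by
  apply pc_unique
  · simp
  · exact List.prefix_append _ _
  · intro Z hZ hp
    by_contra hlt
    have hl := hp.length_le
    simp at hlt hl
    have h1 := hp.getElem (i := m) (by simp)
    have h2 := pal_getElem hZ m (by omega)
    have h3 := hp.getElem (i := Z.length - 1 - m) (by simp; omega)
    rw [List.getElem_append_left (by simp; omega)] at h3
    simp at h1 h3
    rw [← h3] at h2
    rw [h2] at h1
    simp at h1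

theorem block_inv (c : Bool) (m : ℕ) (hm : 1 ≤ m) :
    PalInv (replicate m c ++ [!c] ++ replicate m c) := by
  obtain ⟨n, rfl⟩ : ∃ n, m = n + 1 := ⟨m - 1, by omega⟩
  refine ⟨by simp, fun x => ?_⟩
  have hmax : ∀ R' : List Bool, R'.reverse = R' → ∀ y,
      R' ++ [y] <+: replicate (n+1) c ++ [!c] ++ replicate (n+1) c →
      R'.length ≤ n + 1 ∧ y = if R'.length = n + 1 then !c else c := by
    intro R' hR' y hy
    have hl := hy.length_le
    simp at hl
    constructor
    · by_contra hlt
      have h0 := (List.prefix_append R' [y]).trans hy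
      have h1 := h0.getElem (i := n + 1) (by omega)
      have h2 := pal_getElem hR' (n + 1) (by omega)
      have h3 := h0.getElem (i := R'.length - 1 - (n + 1)) (by omega)
      rw [block_getElem] at h1 h3
      rw [if_pos rfl] at h1
      rw [if_neg (by omega)] at h3
      rw [h1, h3] at h2
      simp at h2
    · have h1 := hy.getElem (i := R'.length) (by simp)
      rw [block_getElem] at h1
      simpa using h1
  by_cases hx : x = c
  · subst hx
    refine ⟨replicate n x, by simp, ⟨replicate (n+1) x, ?_⟩, fun R' hR' h => ?_⟩
    · simp [List.replicate_succ' (n := n)]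
    · obtain ⟨h1, h2⟩ := hmax R' hR' _ h
      simp only [List.length_replicate]
      by_contra h3
      rw [if_pos (by omega)] at h2
      simp at h2
  · have hx' : x = !c := by cases x <;> cases c <;> simp_all
    subst hx'
    refine ⟨replicate (n+1) c, by simp, ⟨replicate n c, ?_⟩, fun R' hR' h => ?_⟩
    · simp [List.replicate_succ]
    · simpa using (hmax R' hR' _ h).1

/-! ### Sequences -/

noncomputable def WW (Δ : ℕ → Bool) (n : ℕ) : List Bool :=
  psiWord (List.ofFn fun i : Fin n => Δ i.1)

noncomputable def TT (t : ℕ → List Bool) (n : ℕ) : List Bool :=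
  psiList (List.ofFn fun i : Fin n => t i.1)

theorem WW_succ (Δ : ℕ → Bool) (n : ℕ) : WW Δ (n + 1) = palClosure (WW Δ n ++ [Δ n]) := by
  unfold WW psiWord
  rw [List.ofFn_succ_last, List.foldl_append]
  simp

theorem TT_succ (t : ℕ → List Bool) (n : ℕ) : TT t (n + 1) = palClosure (TT t n ++ t n) := by
  unfold TT psiList
  rw [List.ofFn_succ_last, List.foldl_append]
  simp

theorem WW_mono (Δ : ℕ → Bool) {n m : ℕ} (h : n ≤ m) : WW Δ n <+: WW Δ m := by
  induction m, h using Nat.le_induction with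
  | base => exact List.prefix_refl _
  | succ m _ ih =>
    rw [WW_succ]
    exact ih.trans ((List.prefix_append _ _).trans (pc_hasPre _))

theorem TT_mono (t : ℕ → List Bool) {n m : ℕ} (h : n ≤ m) : TT t n <+: TT t m := by
  induction m, h using Nat.le_induction with
  | base => exact List.prefix_refl _
  | succ m _ ih =>
    rw [TT_succ]
    exact ih.trans ((List.prefix_append _ _).trans (pc_hasPre _))

theorem prefixOfInf_mono {u v : List Bool} {s : ℕ → Bool} (h : u <+: v) (hv : PrefixOfInf v s) :
    PrefixOfInf u s := by
  intro i hi
  have := hv i (hi.trans_le h.length_le)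
  rw [← this]
  simpa using h.getElem hi

theorem WW_block (Δ : ℕ → Bool) (c : Bool) (m : ℕ) (h : ∀ i < m, Δ i = c) :
    WW Δ m = replicate m c := by
  induction m with
  | zero => rfl
  | succ m ih =>
    rw [WW_succ, ih (fun i hi => h i (by omega)), h m (by omega), ← List.replicate_succ']
    exact pc_of_pal (by simp)

theorem TT_block (t : ℕ → List Bool) (c : Bool) (m : ℕ) (h : ∀ i < m, t i = [c, c]) :
    TT t m = replicate (2 * m) c := by
  induction m with
  | zero => rfl
  | succ m ih =>
    have e : replicate (2 * m) c ++ [c, c] = replicate (2 * (m + 1)) c := by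
      rw [show 2 * (m + 1) = 2 * m + 2 by ring, List.replicate_add]; rfl
    rw [TT_succ, ih (fun i hi => h i (by omega)), h m (by omega), e]
    exact pc_of_pal (by simp)

theorem main_eq (Δ : ℕ → Bool) (t : ℕ → List Bool) (c : Bool) (m k : ℕ)
    (hΔ : ∀ i < m, Δ i = c) (hΔm : Δ m = !c) (ht : ∀ i < k, t i = [c, c])
    (hk : (m = 2 * k + 1 ∧ t k = [c, !c]) ∨ (m = 2 * k ∧ 1 ≤ k ∧ t k = [!c, c]))
    (hj : ∀ j ≥ 1, t (k + j) = [Δ (m + j), !Δ (m + j)]) (j : ℕ) :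
    TT t (k + 1 + j) = WW Δ (m + 1 + j) ∧ PalInv (WW Δ (m + 1 + j)) := by
  induction j with
  | zero =>
    have hm : 1 ≤ m := by omega
    have hW : WW Δ (m + 1) = replicate m c ++ [!c] ++ replicate m c := by
      rw [WW_succ, WW_block Δ c m hΔ, hΔm, block_closure]
    refine ⟨?_, by rw [Nat.add_zero, hW]; exact block_inv c m hm⟩
    rw [Nat.add_zero, Nat.add_zero, hW, TT_succ, TT_block t c k ht, ← block_closure]
    rcases hk with ⟨h1, h2⟩ | ⟨h1, h2, h3⟩
    · rw [h2, h1, List.replicate_succ']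
      simp
    · rw [h3, ← h1]
      apply pc_between ⟨[c], by simp⟩
      rw [block_closure]
      obtain ⟨n, hn⟩ : ∃ n, m = n + 1 := ⟨m - 1, by omega⟩
      refine ⟨replicate n c, ?_⟩
      rw [hn]
      simp [List.replicate_succ (n := n)]
  | succ j ih =>
    obtain ⟨h1, h2⟩ := ih
    rw [show k + 1 + (j + 1) = (k + 1 + j) + 1 by ring,
      show m + 1 + (j + 1) = (m + 1 + j) + 1 by ring, TT_succ, WW_succ, h1,
      show k + 1 + j = k + (j + 1) by ring, hj (j + 1) (by omega),
      show m + 1 + j = m + (j + 1) by ring] at *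
    exact ⟨h2.two _, h2.closure _⟩

theorem main_iff (s : ℕ → Bool) (Δ : ℕ → Bool) (t : ℕ → List Bool) (m k : ℕ)
    (h : ∀ j, TT t (k + 1 + j) = WW Δ (m + 1 + j)) :
    (∀ n, PrefixOfInf (WW Δ n) s) ↔ (∀ n, PrefixOfInf (TT t n) s) := by
  constructor
  · intro H n
    exact prefixOfInf_mono (TT_mono t (by omega : n ≤ k + 1 + n)) (by rw [h]; exact H _)
  · intro H n
    exact prefixOfInf_mono (WW_mono Δ (by omega : n ≤ m + 1 + n)) (by rw [← h]; exact H _)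

theorem alternating_heads {t : ℕ → List Bool} (hl : ∀ i, (t i).length = 2) (ha : Alternating t)
    (k : ℕ) (hk : ∀ i ≥ k, t i = [true, false] ∨ t i = [false, true]) (x : Bool) (N : ℕ) :
    ∃ n ≥ N, t n = [x, !x] := by
  obtain ⟨a, b, hab, lam, idx, hmono, h⟩ := ha
  have hidx : ∀ n, n ≤ idx n := fun _ => hmono.le_apply
  have hN : ∀ y : Bool, ∃ n ≥ max N k, lam ++ [y] <+: t n := by
    intro y
    have h1 := hidx (2 * max N k)
    have h2 := hidx (2 * max N k + 1)
    by_cases hy : y = a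
    · subst hy
      exact ⟨_, by omega, (h (max N k)).1⟩
    · have : y = b := by cases y <;> cases a <;> cases b <;> simp_all
      subst this
      exact ⟨_, by omega, (h (max N k)).2⟩
  rcases lam with _ | ⟨e, lam⟩
  · obtain ⟨n, hn, hp⟩ := hN x
    refine ⟨n, by omega, ?_⟩
    rcases hk n (by omega) with h1 | h1 <;> rw [h1] at hp ⊢ <;> cases x <;> simp_all
  · exfalso
    obtain ⟨n, hn, hp⟩ := hN e
    have h2 := hp.length_le
    rw [hl] at h2
    have : lam = [] := by
      simpa using h2
    subst this
    rcases hk n (by omega) with h1 | h1 <;> rw [h1] at hp <;> cases e <;> simp_all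

theorem heads_alternating {t : ℕ → List Bool} (h : ∀ x N, ∃ n ≥ N, t n = [x, !x]) :
    Alternating t := by
  choose f hf1 hf2 using h
  let idx : ℕ → ℕ := fun n => Nat.rec (f true 0) (fun i r => f (decide ((i + 1) % 2 = 0)) (r + 1)) n
  have hs : ∀ i, idx (i + 1) = f (decide ((i + 1) % 2 = 0)) (idx i + 1) := fun i => rfl
  have ht : ∀ i, t (idx i) = [decide (i % 2 = 0), !decide (i % 2 = 0)] := by
    intro i
    rcases i with _ | i
    · exact hf2 true 0
    · rw [hs]; exact hf2 _ _
  refine ⟨true, false, by simp, [], idx, strictMono_nat_of_lt_succ fun i => ?_, fun j => ?_⟩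
  · rw [hs]; exact hf1 _ _
  · rw [ht (2 * j), ht (2 * j + 1)]
    have h1 : (2 * j) % 2 = 0 := by omega
    have h2 : (2 * j + 1) % 2 = 1 := by omega
    simp [h1, h2]

/-- Over `A = {a,b}` (here `Bool`) and `X = A²`, an infinite
word `s` is standard Sturmian iff `s = ψ_X(t)` for some alternating
`t ∈ ((aa)* ∪ (bb)*){ab, ba}^ω`. -/
theorem stmt7 (s : ℕ → Bool) :
    (∃ Δ : ℕ → Bool, (∀ b : Bool, ∀ N : ℕ, ∃ n ≥ N, Δ n = b) ∧
      ∀ n : ℕ, PrefixOfInf (psiWord (List.ofFn fun i : Fin n => Δ i.1)) s) ↔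
    (∃ t : ℕ → List Bool, (∀ i, (t i).length = 2) ∧ Alternating t ∧
      (∃ (k : ℕ) (c : Bool), (∀ i < k, t i = [c, c]) ∧
        ∀ i ≥ k, t i = [true, false] ∨ t i = [false, true]) ∧
      ∀ n : ℕ, PrefixOfInf (psiList (List.ofFn fun i : Fin n => t i.1)) s) := by
  change (∃ Δ : ℕ → Bool, (∀ b : Bool, ∀ N : ℕ, ∃ n ≥ N, Δ n = b) ∧
      ∀ n : ℕ, PrefixOfInf (WW Δ n) s) ↔
    (∃ t : ℕ → List Bool, (∀ i, (t i).length = 2) ∧ Alternating t ∧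
      (∃ (k : ℕ) (c : Bool), (∀ i < k, t i = [c, c]) ∧
        ∀ i ≥ k, t i = [true, false] ∨ t i = [false, true]) ∧
      ∀ n : ℕ, PrefixOfInf (TT t n) s)
  have hpair : ∀ x : Bool, [x, !x] = [true, false] ∨ [x, !x] = [false, true] := by decide
  constructor
  · rintro ⟨Δ, hinf, hpre⟩
    obtain ⟨c, m, hm1, hΔ, hΔm⟩ : ∃ (c : Bool) (m : ℕ), 1 ≤ m ∧ (∀ i < m, Δ i = c) ∧
        Δ m = !c := by
      have hex : ∃ n, Δ n = !(Δ 0) := by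
        obtain ⟨n, -, hn⟩ := hinf (!(Δ 0)) 0
        exact ⟨n, hn⟩
      refine ⟨Δ 0, Nat.find hex, ?_, fun i hi => ?_, Nat.find_spec hex⟩
      · rw [Nat.one_le_iff_ne_zero]
        intro h0
        have := Nat.find_spec hex
        rw [h0] at this
        simp at this
      · have := Nat.find_min hex hi
        simpa using this
    let k := m / 2
    let t : ℕ → List Bool := fun i =>
      if i < k then [c, c] else if i = k then (if m % 2 = 1 then [c, !c] else [!c, c])
      else [Δ (m + (i - k)), !Δ (m + (i - k))]
    have ht1 : ∀ i < k, t i = [c, c] := fun i hi => by simp [t, hi]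
    have ht2 : t k = if m % 2 = 1 then [c, !c] else [!c, c] := by simp [t]
    have ht3 : ∀ j ≥ 1, t (k + j) = [Δ (m + j), !Δ (m + j)] := fun j hj => by
      have h1 : j ≠ 0 := by omega
      simp [t, h1]
    have hkm : k = m / 2 := rfl
    have hk : (m = 2 * k + 1 ∧ t k = [c, !c]) ∨ (m = 2 * k ∧ 1 ≤ k ∧ t k = [!c, c]) := by
      rcases Nat.mod_two_eq_zero_or_one m with h | h
      · right; refine ⟨by omega, by omega, by rw [ht2, if_neg (by omega)]⟩
      · left; refine ⟨by omega, by rw [ht2, if_pos h]⟩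
    have hge : ∀ i ≥ k, t i = [true, false] ∨ t i = [false, true] := by
      intro i hi
      rcases hi.eq_or_lt with h | h
      · rw [← h]
        rcases hk with ⟨-, h⟩ | ⟨-, -, h⟩ <;> rw [h]
        · exact hpair c
        · simpa using hpair (!c)
      · have := ht3 (i - k) (by omega)
        rw [show k + (i - k) = i by omega] at this
        rw [this]; exact hpair _
    refine ⟨t, fun i => ?_, heads_alternating fun x N => ?_, ⟨k, c, ht1, hge⟩, ?_⟩
    · rcases lt_or_ge i k with h | h
      · rw [ht1 i h]; rfl
      · rcases hge i h with h | h <;> rw [h] <;> rfl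
    · obtain ⟨n, hn, hx⟩ := hinf x (N + m + 1)
      refine ⟨k + (n - m), by omega, ?_⟩
      rw [ht3 _ (by omega), show m + (n - m) = n by omega, hx]
    · exact (main_iff s Δ t m k fun j => (main_eq Δ t c m k hΔ hΔm ht1 hk ht3 j).1).1 hpre
  · rintro ⟨t, hl, ha, ⟨k, c, ht, hge⟩, hpre⟩
    have hheads := alternating_heads hl ha k hge
    obtain ⟨c, m, ht, hk⟩ : ∃ (c : Bool) (m : ℕ), (∀ i < k, t i = [c, c]) ∧
        ((m = 2 * k + 1 ∧ t k = [c, !c]) ∨ (m = 2 * k ∧ 1 ≤ k ∧ t k = [!c, c])) := by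
      have h1 : t k = [c, !c] ∨ t k = [!c, c] := by
        rcases hge k le_rfl with h | h <;> rw [h] <;> cases c <;> simp
      rcases h1 with h1 | h1
      · exact ⟨c, 2 * k + 1, ht, Or.inl ⟨rfl, h1⟩⟩
      · by_cases hk0 : 1 ≤ k
        · exact ⟨c, 2 * k, ht, Or.inr ⟨rfl, hk0, h1⟩⟩
        · exact ⟨!c, 2 * k + 1, fun i hi => by omega, Or.inl ⟨rfl, by simpa using h1⟩⟩
    let Δ : ℕ → Bool := fun i => if i < m then c else if i = m then !c
      else (t (k + (i - m))).headD true
    have hΔ : ∀ i < m, Δ i = c := fun i hi => by simp [Δ, hi]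
    have hΔm : Δ m = !c := by simp [Δ]
    have hΔj : ∀ j ≥ 1, Δ (m + j) = (t (k + j)).headD true := fun j hj => by
      have h1 : j ≠ 0 := by omega
      simp [Δ, h1]
    have ht3 : ∀ j ≥ 1, t (k + j) = [Δ (m + j), !Δ (m + j)] := fun j hj => by
      rw [hΔj j hj]
      rcases hge (k + j) (by omega) with h | h <;> rw [h] <;> rfl
    refine ⟨Δ, fun x N => ?_,
      (main_iff s Δ t m k fun j => (main_eq Δ t c m k hΔ hΔm ht hk ht3 j).1).2 hpre⟩
    obtain ⟨n, hn, hx⟩ := hheads x (N + k + 1)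
    refine ⟨m + (n - k), by omega, ?_⟩
    rw [hΔj _ (by omega), show k + (n - k) = n by omega, hx]
    rfl
end

section
/- Every X-AR word over the alphabet A is a morphic image of a standard Arnoux–Rauzy word over an alphabet B with card(B) = card(X): if s is an X-AR word, there exist an alphabet B with card(B) = card(X), a morphism φ : B* → A*, and a standard Arnoux–Rauzy word t over B such that s = φ(t). -/
open List

namespace XAR

def Pal {A : Type*} (s : ℕ → A) (m : ℕ) : Prop := ∀ i j, i + j + 1 = m → s i = s j

def PalSeg {A : Type*} (s : ℕ → A) (a b : ℕ) : Prop :=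
  ∀ i j, a ≤ i → a ≤ j → i + j + 1 = a + b → s i = s j

def pre {A : Type*} (s : ℕ → A) (n : ℕ) : List A := (List.range n).map s

@[simp] lemma pre_length {A : Type*} (s : ℕ → A) (n : ℕ) : (pre s n).length = n := by
  simp [pre]

lemma eq_pre {A : Type*} {w : List A} {s : ℕ → A} (h : PrefixOfInf w s) :
    w = pre s w.length := by
  apply List.ext_getElem
  · simp
  · intro i h1 h2
    have := h i h1
    simpa [pre] using this

lemma pre_prefix {A : Type*} (s : ℕ → A) (n : ℕ) : PrefixOfInf (pre s n) s := by
  intro i h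
  simp [pre]

lemma prefixOf_append_left {A : Type*} {u v : List A} {s : ℕ → A}
    (h : PrefixOfInf (u ++ v) s) : PrefixOfInf u s := by
  intro i hi
  have := h i (by simp; omega)
  simpa [List.getElem_append, hi] using this

lemma drop_pal_iff {A : Type*} {w : List A} {s : ℕ → A} (h : PrefixOfInf w s) (k : ℕ)
    (hk : k ≤ w.length) :
    (w.drop k).reverse = w.drop k ↔ PalSeg s k w.length := by
  have h' : ∀ i (hi : i < w.length), w[i] = s i := fun i hi => by simpa using h i hi
  constructor
  · intro e i j hi hj hij
    have := congrArg (fun l => l[i - k]?) e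
    rw [List.getElem?_eq_getElem (by simp; omega), List.getElem?_eq_getElem (by simp; omega)] at this
    simp only [List.getElem_reverse, List.getElem_drop, h', Option.some.injEq, List.length_drop] at this
    rw [show k + (i - k) = i by omega, show k + (w.length - k - 1 - (i - k)) = j by omega] at this
    exact this.symm
  · intro e
    apply List.ext_getElem
    · simp
    · intro i h1 h2
      simp only [List.getElem_reverse, List.getElem_drop, h', List.length_drop]
      simp at h1
      apply e <;> omega

lemma palClosure_spec {A : Type*} {w : List A} {s : ℕ → A} (h : PrefixOfInf (palClosure w) s) :
    PrefixOfInf w s ∧ ∃ k ≤ w.length, (palClosure w).length = w.length + k ∧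
      Pal s (w.length + k) ∧ ∀ j, PalSeg s j w.length → k ≤ j := by
  classical
  have hex : ∃ k, (w.drop k).reverse = w.drop k := ⟨w.length, by simp⟩
  obtain ⟨k, hk, hkl, hkp, hkm⟩ : ∃ k, palClosure w = w ++ (w.take k).reverse ∧ k ≤ w.length ∧
      (w.drop k).reverse = w.drop k ∧ ∀ j, (w.drop j).reverse = w.drop j → k ≤ j := by
    refine ⟨Nat.find hex, ?_, Nat.find_min' hex (by simp), Nat.find_spec hex, fun j hj =>
      Nat.find_min' hex hj⟩
    unfold palClosure
    congr
  have hw : PrefixOfInf w s := prefixOf_append_left (hk ▸ h)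
  refine ⟨hw, k, hkl, by rw [hk]; simp [hkl], ?_, ?_⟩
  · have key : ∀ i j, i + j + 1 = w.length + k → w.length ≤ j → s i = s j := by
      intro i j hij hj
      have h1 := h j (by rw [hk]; simp; omega)
      have h2 := hw i (by omega)
      simp only [List.get_eq_getElem, hk] at h1 h2
      rw [List.getElem_append_right hj] at h1
      simp only [List.getElem_reverse, List.getElem_take, List.length_take] at h1
      rw [← h1, ← h2]
      congr 1
      omega
    intro i j hij
    by_cases hj : w.length ≤ j
    · exact key i j hij hj
    by_cases hi : w.length ≤ i
    · exact (key j i (by omega) hi).symm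
    exact (drop_pal_iff hw k hkl).1 hkp i j (by omega) (by omega) (by omega)
  · intro j hj
    by_cases hjl : j ≤ w.length
    · exact hkm j ((drop_pal_iff hw j hjl).2 hj)
    · omega

structure Sys {A : Type*} (s : ℕ → A) (l : ℕ → ℕ) (y : ℕ → List A) : Prop where
  zero : l 0 = 0
  ne : ∀ n, 0 < (y n).length
  le : ∀ n, l n + (y n).length ≤ l (n + 1)
  le2 : ∀ n, l (n + 1) ≤ 2 * (l n + (y n).length) - 1
  pal : ∀ n, Pal s (l n)
  segmin : ∀ n j, PalSeg s j (l n + (y n).length) → l (n + 1) ≤ l n + (y n).length + j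
  letters : ∀ n i (h : i < (y n).length), s (l n + i) = (y n)[i]

lemma sys_of {A : Type*} {s : ℕ → A} {y : ℕ → List A} (p : ℕ → List A) (h0 : p 0 = [])
    (hp : ∀ n, p (n + 1) = palClosure (p n ++ y n)) (hs : ∀ n, PrefixOfInf (p n) s)
    (hy : ∀ n, y n ≠ []) : Sys s (fun n => (p n).length) y := by
  have hsp : ∀ n, _ := fun n => palClosure_spec (hp n ▸ hs (n + 1))
  have hpos : ∀ n, 0 < (y n).length := fun n => List.length_pos_iff.2 (hy n)
  refine ⟨by simp [h0], hpos, ?_, ?_, ?_, ?_, ?_⟩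
  · intro n
    obtain ⟨_, k, _, h1, _⟩ := hsp n
    simp only [hp n, h1, List.length_append]; omega
  · intro n
    obtain ⟨_, k, hk, h1, h2, h3⟩ := hsp n
    have := h3 ((p n ++ y n).length - 1) (by
      intro i j hi hj hij
      have := hpos n
      simp only [List.length_append] at *
      rw [show i = j by omega])
    have := hpos n
    simp only [hp n, h1, List.length_append] at *; omega
  · intro n
    cases n with
    | zero => intro i j h; simp [h0] at h
    | succ n =>
      obtain ⟨_, k, hk, h1, h2, h3⟩ := hsp n
      simp only [hp n, h1]
      exact h2
  · intro n j hj
    obtain ⟨_, k, hk, h1, h2, h3⟩ := hsp n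
    have := h3 j (by simpa using hj)
    simp only [hp n, h1, List.length_append]; omega
  · intro n i hi
    obtain ⟨hw, _⟩ := hsp n
    have := hw ((p n).length + i) (by simp; omega)
    simpa using this.symm

namespace Sys
variable {A : Type*} {s : ℕ → A} {l : ℕ → ℕ} {y : ℕ → List A}

lemma strictMono (S : Sys s l y) : StrictMono l :=
  strictMono_nat_of_lt_succ fun n => by have := S.le n; have := S.ne n; omega

lemma no_pal (S : Sys s l y) {n m : ℕ} (h1 : l n + (y n).length ≤ m) (h2 : m < l (n + 1)) :
    ¬ Pal s m := by
  intro h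
  have := S.segmin n (m - (l n + (y n).length)) (by
    intro i j _ _ hij
    exact h i j (by omega))
  omega

/-- locating m between two consecutive values -/
lemma between (S : Sys s l y) (m : ℕ) : ∃ n, l n ≤ m ∧ m < l (n + 1) := by
  classical
  have hex : ∃ n, m < l n := ⟨m + 1, lt_of_lt_of_le (Nat.lt_succ_self m) (S.strictMono.id_le _)⟩
  have h1 := Nat.find_spec hex
  obtain ⟨n, hn⟩ : ∃ n, Nat.find hex = n + 1 := by
    refine Nat.exists_eq_succ_of_ne_zero ?_
    intro h
    rw [h, S.zero] at h1
    omega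
  refine ⟨n, ?_, hn ▸ h1⟩
  have := Nat.find_min hex (m := n) (by omega)
  omega

/-- The palindromic shift: s (l n + i) = s (Q + i). -/
lemma shift (S : Sys s l y) {n Q i : ℕ} (hQ : Q + l (n + 1) = 2 * l n)
    (hi : l n + i < l (n + 1)) : s (l n + i) = s (Q + i) := by
  have h1 := S.pal (n + 1) (l n + i) (l (n + 1) - 1 - l n - i) (by omega)
  have h2 := S.pal n (l (n + 1) - 1 - l n - i) (Q + i) (by omega)
  rw [h1, h2]

lemma palQ (S : Sys s l y) {n Q : ℕ} (hQ : Q + l (n + 1) = 2 * l n) : Pal s Q := by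
  intro i j hij
  have hlt := S.strictMono (Nat.lt_succ_self n)
  simp only [Nat.succ_eq_add_one] at hlt
  have h1 := S.pal n i (l n - 1 - i) (by omega)
  have h4 := S.pal (n+1) (l n - 1 - i) (l (n+1) - l n + i) (by omega)
  have h5 := S.pal n (l (n+1) - l n + i) j (by omega)
  rw [h1, h4, h5]

lemma upper (S : Sys s l y) {n k : ℕ} (hk : k < n) (hx : y k = y n) :
    l (n + 1) + l k ≤ 2 * l n := by
  have a1 := S.le k
  have a2 := S.strictMono.monotone (Nat.succ_le_of_lt hk)
  have a3 : (y k).length = (y n).length := by rw [hx]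
  simp only [Nat.succ_eq_add_one] at a2
  have key : ∀ i j, l n - l k - (y n).length ≤ i → i < l n - l k → 
      i + j + 1 = 2 * l n - l k → s i = s j := by
    intro i j hi hi2 hij
    have h1 := S.pal n i (l n - 1 - i) (by omega)
    have h2 := S.letters k (l n - 1 - i - l k) (by omega)
    have h3 := S.letters n (l n - 1 - i - l k) (by omega)
    rw [show l k + (l n - 1 - i - l k) = l n - 1 - i by omega] at h2
    rw [show l n + (l n - 1 - i - l k) = j by omega] at h3
    rw [h1, h2, h3]
    simp only [hx]
  have := S.segmin n (l n - l k - (y n).length) (by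
    intro i j hi hj hij
    by_cases hi2 : i < l n - l k
    · exact key i j hi hi2 (by omega)
    by_cases hj2 : j < l n - l k
    · exact (key j i hj hj2 (by omega)).symm
    have h1 := S.pal n i (l n - 1 - i) (by omega)
    have h2 := S.pal k (l n - 1 - i) (l k + i - l n) (by omega)
    have h3 := S.pal n (l k + i - l n) j (by omega)
    rw [h1, h2, h3])
  omega

def Good (s : ℕ → A) (l : ℕ → ℕ) (N : ℕ) : Prop := ∀ m, l N ≤ m → Pal s m → ∃ n, N ≤ n ∧ m = l n

def Pref (y : ℕ → List A) : Prop := ∀ i j, y i <+: y j → y i = y j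

lemma same_word (S : Sys s l y) (hy : Pref y) {j n : ℕ}
    (h : ∀ i, i < (y n).length → s (l j + i) = s (l n + i)) : y j = y n := by
  have key : ∀ a b, (∀ i, i < (y a).length → i < (y b).length → s (l a + i) = s (l b + i)) →
      (y a).length ≤ (y b).length → y a = y b := by
    intro a b hab hle
    apply hy
    rw [List.prefix_iff_eq_take]
    apply List.ext_getElem
    · simp [hle]
    · intro i h1 h2
      rw [List.getElem_take, ← S.letters a i h1, ← S.letters b i (by omega)]
      exact hab i h1 (by omega)
  rcases le_total (y j).length (y n).length with hle | hle
  · exact key j n (fun i _ h2 => h i h2) hle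
  · exact (key n j (fun i h1 _ => (h i h1).symm) hle).symm

lemma find_j (S : Sys s l y) (hy : Pref y) {N n Q : ℕ} (hN : Good s l N)
    (hQ : Q + l (n + 1) = 2 * l n) (hNQ : l N ≤ Q) : ∃ j, N ≤ j ∧ j < n ∧ Q = l j ∧ y j = y n := by
  obtain ⟨j, hj, rfl⟩ := hN Q hNQ (S.palQ hQ)
  have hlt := S.strictMono (Nat.lt_succ_self n)
  have hle := S.le n
  refine ⟨j, hj, S.strictMono.lt_iff_lt.1 (by simp only [Nat.succ_eq_add_one] at hlt; omega), rfl, S.same_word hy ?_⟩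
  intro i hi
  exact (S.shift hQ (by omega)).symm

lemma recur (S : Sys s l y) (hy : Pref y) {N n k : ℕ} (hN : Good s l N) (hNk : N ≤ k)
    (hk : k < n) (hx : y k = y n) (hlast : ∀ j, k < j → j < n → y j ≠ y n) :
    l (n + 1) + l k = 2 * l n := by
  have h1 := S.upper hk hx
  have h2 := S.strictMono.monotone hNk
  obtain ⟨j, hj, hjn, hQ, hyj⟩ := S.find_j hy (n := n) (Q := 2 * l n - l (n + 1)) hN (by omega) (by omega)
  have hkj : k ≤ j := S.strictMono.le_iff_le.1 (by omega)
  rcases hkj.eq_or_lt with rfl | h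
  · omega
  · exact absurd hyj (hlast j h hjn)

lemma recur_new (S : Sys s l y) (hy : Pref y) {n : ℕ} (hN : Good s l 0) (h1 : (y n).length = 1)
    (hnew : ∀ j, j < n → y j ≠ y n) : l (n + 1) = 2 * l n + 1 := by
  have h2 := S.le2 n
  by_contra hne
  obtain ⟨j, hj, hjn, hQ, hyj⟩ := S.find_j hy (n := n) (Q := 2 * l n - l (n + 1)) hN (by omega)
    (by rw [S.zero]; omega)
  exact hnew j hjn hyj

lemma good_letters (S : Sys s l y) (h1 : ∀ n, (y n).length = 1) : Good s l 0 := by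
  intro m _ hm
  obtain ⟨n, h2, h3⟩ := S.between m
  refine ⟨n, Nat.zero_le _, ?_⟩
  by_contra hne
  exact S.no_pal (n := n) (by rw [h1]; omega) h3 hm

lemma exists_good (S : Sys s l y) (L : ℕ) (hL : ∀ n, (y n).length ≤ L)
    (hne : ∀ N, ∃ a b, N ≤ a ∧ N ≤ b ∧ s (l a) ≠ s (l b)) : ∃ N, Good s l N := by
  by_contra hcon
  push Not at hcon
  have per : ∀ i, s (i + L.factorial) = s i := by
    intro i
    have := hcon (i + L.factorial)
    unfold Good at this
    push Not at this
    obtain ⟨m, hm, hpal, hno⟩ := this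
    obtain ⟨n, h2, h3⟩ := S.between m
    have hn : i + L.factorial ≤ n := by
      have := S.strictMono.lt_iff_lt.1 (lt_of_le_of_lt hm h3)
      omega
    have hlen := S.no_pal (n := n) (m := m)
    have hlt : m < l n + (y n).length := by
      by_contra h; exact hlen (by omega) h3 hpal
    have hmn := hno n hn
    have hLn := hL n
    have hln : n ≤ l n := S.strictMono.id_le n
    have step : ∀ j, j < l n → s (j + (m - l n)) = s j := by
      intro j hj
      rw [hpal (j + (m - l n)) (l n - 1 - j) (by omega), S.pal n (l n - 1 - j) j (by omega)]
    have hdvd : (m - l n) ∣ L.factorial := Nat.dvd_factorial (by omega) (by omega)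
    obtain ⟨c, hc⟩ := hdvd
    have : ∀ c', c' ≤ c → s (i + (m - l n) * c') = s i := by
      intro c'
      induction c' with
      | zero => simp
      | succ c' ih =>
        intro hc'
        have hmul : (m - l n) * (c' + 1) ≤ L.factorial := by
          rw [hc]; exact Nat.mul_le_mul_left _ hc'
        rw [Nat.mul_add, Nat.mul_one] at hmul
        rw [Nat.mul_add, Nat.mul_one, ← add_assoc, step _ (by omega)]
        exact ih (by omega)
    rw [hc]
    exact this c le_rfl
  obtain ⟨a, b, ha, hb, hab⟩ := hne (L.factorial)
  have key : ∀ a b, L.factorial ≤ a → a ≤ b → s (l a) = s (l b) := by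
    intro a b ha hab
    have h1 := S.strictMono.monotone hab
    have h2 : a ≤ l a := S.strictMono.id_le a
    have hD := Nat.factorial_pos L
    have e1 := per (l a - L.factorial)
    have e2 := per (l b - L.factorial)
    rw [show l a - L.factorial + L.factorial = l a by omega] at e1
    rw [show l b - L.factorial + L.factorial = l b by omega] at e2
    rw [e1, e2, S.pal a (l a - L.factorial) (L.factorial - 1) (by omega),
      S.pal b (l b - L.factorial) (L.factorial - 1) (by omega)]
  rcases le_total a b with h | h
  · exact hab (key a b ha h)
  · exact hab (key b a hb h).symm

lemma pre_recur (S : Sys s l y) {n k : ℕ} (hk : l (n + 1) + l k = 2 * l n) :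
    pre s (l (n + 1)) = (pre s (l n)).take (l n - l k) ++ pre s (l n) := by
  have hlt := S.strictMono (Nat.lt_succ_self n)
  simp only [Nat.succ_eq_add_one] at hlt
  apply List.ext_getElem
  · simp; omega
  · intro i h1 h2
    rw [List.getElem_append]
    simp only [pre_length] at h1
    split_ifs with h
    · simp [pre]
    · simp only [pre, List.length_take, List.length_map, List.length_range, List.getElem_map,
        List.getElem_range] at h ⊢
      rw [min_eq_left (by omega)] at h ⊢
      rw [S.pal (n+1) i (l (n+1) - 1 - i) (by omega), S.pal n _ (i - (l n - l k)) (by omega)]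

lemma pre_recur_new (S : Sys s l y) {n : ℕ} (hk : l (n + 1) = 2 * l n + 1) :
    pre s (l (n + 1)) = pre s (l n) ++ s (l n) :: pre s (l n) := by
  apply List.ext_getElem
  · simp; omega
  · intro i h1 h2
    rw [List.getElem_append]
    simp only [pre_length] at h1
    split_ifs with h
    · simp [pre]
    · rw [List.getElem_cons]
      simp only [pre, List.length_map, List.length_range, List.getElem_map,
        List.getElem_range] at h ⊢
      split_ifs with h'
      · congr 1; omega
      · rw [S.pal (n+1) i (l (n+1) - 1 - i) (by omega), S.pal n _ (i - l n - 1) (by omega)]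

lemma pre_split (S : Sys s l y) {n k : ℕ} (hk : k ≤ n) :
    pre s (l n) = (pre s (l n)).take (l n - l k) ++ pre s (l k) := by
  have hlt := S.strictMono.monotone hk
  apply List.ext_getElem
  · simp; omega
  · intro i h1 h2
    rw [List.getElem_append]
    simp only [pre_length] at h1
    split_ifs with h
    · simp [pre]
    · simp only [pre, List.length_take, List.length_map, List.length_range, List.getElem_map,
        List.getElem_range] at h ⊢
      rw [min_eq_left (by omega)] at h ⊢
      rw [S.pal n i (l n - 1 - i) (by omega), S.pal k _ (i - (l n - l k)) (by omega)]

end Sys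

lemma exists_limit {A : Type*} (p : ℕ → List A) (hp : ∀ n, p n <+: p (n + 1))
    (hl : ∀ n, n ≤ (p n).length) : ∃ t : ℕ → A, ∀ n, PrefixOfInf (p n) t := by
  have mono : ∀ a b, a ≤ b → p a <+: p b := by
    intro a b hab
    induction b, hab using Nat.le_induction with
    | base => exact List.prefix_rfl
    | succ b _ ih => exact ih.trans (hp b)
  refine ⟨fun i => (p (i + 1))[i]'(by have := hl (i + 1); omega), ?_⟩
  intro n i hi
  simp only [List.get_eq_getElem]
  rcases le_total n (i + 1) with h | h
  · exact (mono _ _ h).getElem hi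
  · exact ((mono _ _ h).getElem _).symm

lemma palClosure_prefix {A : Type*} (w : List A) : w <+: palClosure w := by
  unfold palClosure
  exact List.prefix_append _ _

lemma psiList_succ {A : Type*} (y : ℕ → List A) (n : ℕ) :
    psiList (List.ofFn fun i : Fin (n + 1) => y i.1) =
      palClosure (psiList (List.ofFn fun i : Fin n => y i.1) ++ y n) := by
  unfold psiList
  rw [List.ofFn_succ_last, List.foldl_append]
  simp

lemma psiWord_succ {A : Type*} (y : ℕ → A) (n : ℕ) :
    psiWord (List.ofFn fun i : Fin (n + 1) => y i.1) =
      palClosure (psiWord (List.ofFn fun i : Fin n => y i.1) ++ [y n]) := by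
  unfold psiWord
  rw [List.ofFn_succ_last, List.foldl_append]
  simp

/-- Main combinatorial statement. -/
lemma morph {A B : Type*} {s : ℕ → A} {l : ℕ → ℕ} {y : ℕ → List A} (S : Sys s l y)
    {t : ℕ → B} {l' : ℕ → ℕ} {D : ℕ → B} (T : Sys t l' (fun n => [D n])) (hy : Sys.Pref y)
    {N n0 : ℕ} (hN : Sys.Good s l N) (hD : ∀ i j, D i = D j ↔ y (n0 + i) = y (n0 + j))
    (K : B → ℕ) (hKN : ∀ b, N ≤ K b) (hKn : ∀ b, K b < n0)
    (hKy : ∀ i, y (K (D i)) = y (n0 + i))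
    (hKl : ∀ i j, K (D i) < j → j < n0 → y j ≠ y (n0 + i)) (m : ℕ) :
    pre s (l (n0 + m)) =
      ((pre t (l' m)).map fun b => (pre s (l n0)).take (l n0 - l (K b))).flatten ++ pre s (l n0) := by
  classical
  induction m using Nat.strong_induction_on with
  | _ m ih =>
  cases m with
  | zero => simp [T.zero, pre]
  | succ m =>
    have hPT : Sys.Pref (fun n => [D n]) := by
      intro i j h
      exact h.eq_of_length (by simp)
    have hGT : Sys.Good t l' 0 := T.good_letters (by simp)
    have ihm := ih m (by omega)
    set φ : B → List A := fun b => (pre s (l n0)).take (l n0 - l (K b)) with hφ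
    by_cases hex : ∃ j, j < m ∧ D j = D m
    · obtain ⟨j, hj, hjl⟩ : ∃ j, (j < m ∧ D j = D m) ∧ ∀ i, j < i → i < m → D i ≠ D m := by
        have hb : ∀ i, i < m ∧ D i = D m → i ≤ m := fun i hi => hi.1.le
        obtain ⟨j0, hj0⟩ := hex
        refine ⟨Nat.findGreatest (fun i => i < m ∧ D i = D m) m, Nat.findGreatest_spec (P := fun i => i < m ∧ D i = D m) (hb _ hj0) hj0, ?_⟩
        intro i h1 h2 h3
        exact Nat.findGreatest_is_greatest h1 h2.le ⟨h2, h3⟩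
      have r1 := T.recur hPT hGT (Nat.zero_le j) hj.1 (by simp [hj.2]) (by
        intro i h1 h2; simpa using hjl i h1 h2)
      have r2 := S.recur hy hN (n := n0 + m) (k := n0 + j)
        ((hKN (D m)).trans (by have := hKn (D m); omega)) (by omega) ((hD _ _).1 hj.2) (by
          intro i h1 h2
          obtain ⟨i1, rfl⟩ : ∃ i1, i = n0 + i1 := ⟨i - n0, by omega⟩
          rw [Ne, ← hD]
          exact hjl i1 (by omega) (by omega))
      have ihj := ih j (by omega)
      rw [← add_assoc, S.pre_recur r2, T.pre_recur r1]
      have hs1 := T.pre_split hj.1.le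
      set r := (pre t (l' m)).take (l' m - l' j) with hr
      have e : (pre s (l (n0 + m))).take (l (n0 + m) - l (n0 + j)) = (r.map φ).flatten := by
        have e1 : pre s (l (n0 + m)) = (r.map φ).flatten ++ pre s (l (n0 + j)) := by
          rw [ihm, hs1, List.map_append, List.flatten_append, List.append_assoc, ← ihj]
        have e2 := S.pre_split (n := n0 + m) (k := n0 + j) (by omega)
        exact List.append_cancel_right (e2.symm.trans e1)
      rw [e, ihm]
      simp
    · have hex' : ∀ j, j < m → D j ≠ D m := fun j hj h => hex ⟨j, hj, h⟩
      have r1 := T.recur_new hPT (n := m) hGT (by simp) (by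
        intro i h1; simpa using hex' i h1)
      have r2 := S.recur hy hN (n := n0 + m) (k := K (D m)) (hKN _) 
        (by have := hKn (D m); omega) (hKy m) (by
          intro i h1 h2
          by_cases hi : i < n0
          · exact hKl m i h1 hi
          obtain ⟨i1, rfl⟩ : ∃ i1, i = n0 + i1 := ⟨i - n0, by omega⟩
          rw [Ne, ← hD]
          exact hex' i1 (by omega))
      have ht : t (l' m) = D m := by simpa using T.letters m 0 (by simp)
      rw [← add_assoc, S.pre_recur r2, T.pre_recur_new r1, ht]
      have e : (pre s (l (n0 + m))).take (l (n0 + m) - l (K (D m))) =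
          ((pre t (l' m)).map φ).flatten ++ φ (D m) := by
        have e2 := S.pre_split (n := n0 + m) (k := K (D m)) (by have := hKn (D m); omega)
        have e3 := S.pre_split (n := n0) (k := K (D m)) (hKn (D m)).le
        apply List.append_cancel_right (bs := pre s (l (K (D m))))
        rw [← e2, List.append_assoc, hφ, ← e3]
        exact ihm
      rw [e, ihm]
      simp

end XAR

/-- Every `X`-AR word is a morphic image of a standard
Arnoux–Rauzy word over an alphabet `B` with `card B = card X`
(here `B = Fin (card X)`). -/
theorem stmt14 {A : Type*} [Fintype A] (hd : 1 < Fintype.card A)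
    (X : Set (List A)) (hfin : X.Finite) (hX : IsMaximalPrefixCode X)
    (y : ℕ → List A) (hy : ∀ i, y i ∈ X)
    (hpers : ∀ x ∈ X, ∀ N : ℕ, ∃ i ≥ N, y i = x)
    (s : ℕ → A)
    (hs : ∀ n : ℕ, PrefixOfInf (psiList (List.ofFn fun i : Fin n => y i.1)) s) :
    ∃ (φ : Fin X.ncard → List A) (Δ t : ℕ → Fin X.ncard),
      (∀ b : Fin X.ncard, φ b ≠ []) ∧
      (∀ b : Fin X.ncard, ∀ N : ℕ, ∃ n ≥ N, Δ n = b) ∧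
      (∀ n : ℕ, PrefixOfInf (psiWord (List.ofFn fun i : Fin n => Δ i.1)) t) ∧
      (∀ n : ℕ,
        PrefixOfInf (((List.ofFn fun i : Fin n => t i.1).map φ).flatten) s) := by
  classical
  obtain ⟨⟨hXne, hXp⟩, hXmax⟩ := hX
  have S := XAR.sys_of (s := s) (y := y) (fun n => psiList (List.ofFn fun i : Fin n => y i.1))
    (by simp [psiList]) (XAR.psiList_succ y) hs (fun n => hXne _ (hy n))
  set l : ℕ → ℕ := fun n => (psiList (List.ofFn fun i : Fin n => y i.1)).length with hl
  have hyp : XAR.Sys.Pref y := fun i j h => hXp _ (hy i) _ (hy j) h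
  -- two words of X with different first letters
  have hdiff : ∃ x1 ∈ X, ∃ x2 ∈ X, x1.head? ≠ x2.head? := by
    by_contra hcon
    push Not at hcon
    obtain ⟨b, hb⟩ : ∃ b : A, (y 0).head? ≠ some b := by
      obtain ⟨b, c, hbc⟩ := Fintype.exists_pair_of_one_lt_card hd
      by_cases h : (y 0).head? = some b
      · exact ⟨c, by rw [h]; simpa using hbc⟩
      · exact ⟨b, h⟩
    have hall : ∀ x ∈ X, x.head? ≠ some b := fun x hx => by rw [hcon x hx _ (hy 0)]; exact hb
    have hYp : IsPrefixCode (insert [b] X) := by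
      constructor
      · intro x hx
        rcases hx with rfl | hx
        · simp
        · exact hXne x hx
      · intro x hx z hz hxz
        rcases hx with rfl | hx <;> rcases hz with rfl | hz
        · rfl
        · exfalso
          obtain ⟨r, rfl⟩ := hxz
          exact hall _ hz (by simp)
        · exfalso
          obtain ⟨r, hr⟩ := hxz
          have h1 := hXne x hx
          cases x with
          | nil => exact h1 rfl
          | cons a x' =>
            simp at hr
            exact hall _ hx (by simp [hr.1])
        · exact hXp x hx z hz hxz
    have := hXmax _ hYp (Set.subset_insert _ _)
    exact hall [b] (by rw [this]; exact Set.mem_insert _ _) (by simp)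
  obtain ⟨L, hL⟩ : ∃ L, ∀ x ∈ X, x.length ≤ L := by
    obtain ⟨L, hL⟩ := (hfin.image List.length).bddAbove
    exact ⟨L, fun x hx => hL ⟨x, hx, rfl⟩⟩
  have hsl : ∀ n, some (s (l n)) = (y n).head? := by
    intro n
    have h1 := S.letters n 0 (S.ne n)
    rw [List.head?_eq_getElem?, List.getElem?_eq_getElem (S.ne n), ← h1]
    rfl
  obtain ⟨N, hN⟩ := S.exists_good L (fun n => hL _ (hy n)) (by
    intro N
    obtain ⟨x1, h1, x2, h2, h12⟩ := hdiff
    obtain ⟨a, ha, hax⟩ := hpers x1 h1 N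
    obtain ⟨b, hb, hbx⟩ := hpers x2 h2 N
    refine ⟨a, b, ha, hb, ?_⟩
    intro h
    apply h12
    rw [← hax, ← hbx, ← hsl, ← hsl, h])
  -- n0
  obtain ⟨n0, hn0⟩ : ∃ n0, ∀ x ∈ X, ∃ i, N ≤ i ∧ i < n0 ∧ y i = x := by
    choose! f hf using fun x hx => hpers x hx N
    obtain ⟨M, hM⟩ := (hfin.image f).bddAbove
    exact ⟨M + 1, fun x hx => ⟨f x, (hf x hx).1, Nat.lt_succ_of_le (hM ⟨x, hx, rfl⟩), (hf x hx).2⟩⟩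
  have hK : ∀ x ∈ X, ∃ k, N ≤ k ∧ k < n0 ∧ y k = x ∧ ∀ j, k < j → j < n0 → y j ≠ x := by
    intro x hx
    obtain ⟨i, hi⟩ := hn0 x hx
    have h1 := Nat.findGreatest_spec (P := fun i => N ≤ i ∧ i < n0 ∧ y i = x) hi.2.1.le hi
    refine ⟨_, h1.1, h1.2.1, h1.2.2, ?_⟩
    intro j hj hjn hyj
    exact Nat.findGreatest_is_greatest hj hjn.le ⟨by omega, hjn, hyj⟩
  choose! K0 hK1 hK2 hK3 hK4 using hK
  have : Finite X := hfin
  have e : X ≃ Fin X.ncard := by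
    rw [← Nat.card_coe_set_eq]
    exact Finite.equivFin X
  let Δ : ℕ → Fin X.ncard := fun i => e ⟨y (n0 + i), hy _⟩
  have hΔ : ∀ i, (e.symm (Δ i) : List A) = y (n0 + i) := fun i => by simp [Δ]
  let K : Fin X.ncard → ℕ := fun b => K0 (e.symm b)
  let q : ℕ → List (Fin X.ncard) := fun n => psiWord (List.ofFn fun i : Fin n => Δ i.1)
  have hqs : ∀ n, q (n + 1) = palClosure (q n ++ [Δ n]) := XAR.psiWord_succ Δ
  have hqp : ∀ n, q n ++ [Δ n] <+: q (n + 1) := fun n => by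
    rw [hqs]; exact XAR.palClosure_prefix _
  obtain ⟨t, ht⟩ := XAR.exists_limit q (fun n => (List.prefix_append _ _).trans (hqp n)) (by
    intro n
    induction n with
    | zero => simp
    | succ n ih => have := (hqp n).length_le; simp at this; omega)
  have T := XAR.sys_of (s := t) (y := fun n => [Δ n]) q (by simp [q, psiWord]) hqs ht (by simp)
  have hmain := XAR.morph S T hyp hN (n0 := n0) (by
      intro i j
      simp [Δ]) K
    (fun b => hK1 _ (e.symm b).2) (fun b => hK2 _ (e.symm b).2)
    (fun i => by rw [hK3 _ (e.symm (Δ i)).2, hΔ])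
    (fun i j h1 h2 => by rw [← hΔ]; exact hK4 _ (e.symm (Δ i)).2 j h1 h2)
  refine ⟨fun b => (XAR.pre s (l n0)).take (l n0 - l (K b)), Δ, t, ?_, ?_, ht, ?_⟩
  · intro b h
    have h1 := congrArg List.length h
    have h2 := S.strictMono (hK2 _ (e.symm b).2)
    simp only [List.length_take, XAR.pre_length, List.length_nil] at h1
    have h3 : l (K b) < l n0 := h2
    omega
  · intro b M
    obtain ⟨i, hi, hyi⟩ := hpers _ (e.symm b).2 (n0 + M)
    refine ⟨i - n0, by omega, ?_⟩
    apply e.symm.injective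
    apply Subtype.ext
    rw [hΔ, ← hyi]
    congr 1; omega
  · intro n
    have h1 : (List.ofFn fun i : Fin n => t i.1) <+: XAR.pre t (q n).length := by
      have hn : n ≤ (q n).length := T.strictMono.id_le n
      rw [List.prefix_iff_eq_take]
      apply List.ext_getElem
      · simp [hn]
      · intro i h1 h2
        simp [XAR.pre]
    obtain ⟨r, hr⟩ := h1
    have h2 := XAR.pre_prefix s (l (n0 + n))
    rw [hmain n] at h2
    simp only [← hr, List.map_append, List.flatten_append, List.append_assoc] at h2
    exact XAR.prefixOf_append_left h2
end
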